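/- For every positive integer k and every real x ≥ 0, ∫_ℝ e^{ixt}/(t²+1)^k dt = (2πi/(k-1)!) · lim_{z→i} d^{k-1}/dz^{k-1} [e^{ixz}(z+i)^{-k}], i.e. the integral equals 2πi times the residue at z = i of e^{ixz}/(z²+1)^k. -/

import Mathlib

open MeasureTheory Real

open Filter Asymptotics Bornology Topology

/-- The closed upper half-plane. -/
def closedUpperHalfPlane : Set ℂ := {z | 0 ≤ z.im}

/-- The filter of neighbourhoods of infinity in the closed upper half-plane. -/
noncomputable def upperInfty : Filter ℂ := cobounded ℂ ⊓ 𝓟 closedUpperHalfPlane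

lemma tendsto_ofReal_upperInfty :
    Tendsto (fun t : ℝ => (t : ℂ)) (cocompact ℝ) upperInfty := by
  refine tendsto_inf.2 ⟨?_, tendsto_principal.2 (.of_forall fun t => by
    simp [closedUpperHalfPlane])⟩
  rw [← tendsto_norm_atTop_iff_cobounded]
  simpa only [Complex.norm_real] using tendsto_norm_cocompact_atTop (E := ℝ)

lemma ofReal_mem_closedUpperHalfPlane (t : ℝ) : (t : ℂ) ∈ closedUpperHalfPlane := by
  simp [closedUpperHalfPlane]

lemma continuous_comp_ofReal {h : ℂ → ℂ} (hd : ContinuousOn h closedUpperHalfPlane) :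
    Continuous fun t : ℝ => h t :=
  hd.comp_continuous Complex.continuous_ofReal ofReal_mem_closedUpperHalfPlane

lemma integrable_ofReal_of_isBigO {h : ℂ → ℂ} (hc : Continuous fun t : ℝ => h t)
    (hO : h =O[upperInfty] fun z => (z ^ 2)⁻¹) : Integrable fun t : ℝ => h t := by
  refine hc.locallyIntegrable.integrable_of_isBigO_cocompact
    (g := fun t : ℝ => (1 + t ^ 2)⁻¹) ?_ (integrable_inv_one_add_sq.integrableAtFilter _)
  refine (hO.comp_tendsto tendsto_ofReal_upperInfty).trans (.of_bound 2 ?_)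
  filter_upwards [(tendsto_norm_cocompact_atTop (E := ℝ)).eventually_ge_atTop 1] with t ht
  have h1 : 1 ≤ t ^ 2 := by
    rw [← sq_abs]; exact one_le_pow₀ ht
  simp only [Function.comp_apply, norm_inv, norm_pow, Complex.norm_real, Real.norm_eq_abs, sq_abs]
  rw [abs_of_pos (by positivity : 0 < 1 + t ^ 2), ← div_eq_mul_inv, inv_eq_one_div,
    div_le_div_iff₀ (by positivity) (by positivity)]
  linarith

/-- **Cauchy's theorem for the upper half-plane**: a function holomorphic on the closed upper
half-plane and `O(1/z²)` at infinity has zero integral along the real line. -/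
lemma integral_ofReal_eq_zero_of_isBigO {h : ℂ → ℂ}
    (hd : DifferentiableOn ℂ h closedUpperHalfPlane)
    (hO : h =O[upperInfty] fun z => (z ^ 2)⁻¹) : ∫ t : ℝ, h t = 0 := by
  obtain ⟨C, hC0, hC⟩ := hO.exists_pos
  rw [IsBigOWith, upperInfty, eventually_inf_principal, ← comap_norm_atTop,
    eventually_comap] at hC
  obtain ⟨R₀, hR₀⟩ := eventually_atTop.1 hC
  have key (R : ℝ) (hR : 0 < R) (hRR : R₀ ≤ R) (z : ℂ) (hz : 0 ≤ z.im) (hzR : R ≤ ‖z‖) :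
      ‖h z‖ ≤ C / R ^ 2 := by
    refine (hR₀ ‖z‖ (hRR.trans hzR) z rfl hz).trans ?_
    rw [norm_inv, norm_pow, div_eq_mul_inv]
    gcongr
  have hlim := intervalIntegral_tendsto_integral
    (integrable_ofReal_of_isBigO (continuous_comp_ofReal hd.continuousOn) hO)
    tendsto_neg_atTop_atBot tendsto_id
  refine tendsto_nhds_unique hlim (squeeze_zero_norm' (a := fun R : ℝ => 4 * C / R) ?_
    (tendsto_const_nhds.div_atTop tendsto_id))
  filter_upwards [eventually_gt_atTop 0, eventually_ge_atTop R₀] with R hR hRR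
  have hrect := Complex.integral_boundary_rect_eq_zero_of_differentiableOn h (-R : ℝ)
    (R + R * Complex.I) (hd.mono fun z hz => by
      have := hz.2
      simp only [Complex.ofReal_im, Complex.add_im, Complex.mul_im, Complex.ofReal_re,
        Complex.I_im, Complex.I_re, Set.mem_preimage] at this
      rw [Set.uIcc_of_le (by linarith)] at this
      exact this.1)
  simp only [Complex.ofReal_im, Complex.ofReal_re, Complex.add_re, Complex.add_im,
    Complex.mul_re, Complex.mul_im, Complex.I_re, Complex.I_im, Complex.ofReal_zero, zero_mul,
    mul_zero, mul_one, add_zero, zero_add, sub_zero, smul_eq_mul] at hrect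
  have htop : ‖∫ t in -R..R, h (t + R * Complex.I)‖ ≤ C / R ^ 2 * |R - -R| :=
    intervalIntegral.norm_integral_le_of_norm_le_const fun t _ => key R hR hRR _
      (by simpa using hR.le)
      (by simpa [abs_of_pos hR] using Complex.abs_im_le_norm (t + R * Complex.I))
  have hright : ‖∫ y in (0 : ℝ)..R, h (R + y * Complex.I)‖ ≤ C / R ^ 2 * |R - 0| :=
    intervalIntegral.norm_integral_le_of_norm_le_const fun y hy => by
      rw [Set.uIoc_of_le hR.le] at hy
      exact key R hR hRR _ (by simpa using hy.1.le)
        (by simpa [abs_of_pos hR] using Complex.abs_re_le_norm (R + y * Complex.I))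
  have hleft : ‖∫ y in (0 : ℝ)..R, h ((-R : ℝ) + y * Complex.I)‖ ≤ C / R ^ 2 * |R - 0| :=
    intervalIntegral.norm_integral_le_of_norm_le_const fun y hy => by
      rw [Set.uIoc_of_le hR.le] at hy
      exact key R hR hRR _ (by simpa using hy.1.le)
        (by simpa [abs_of_pos hR] using Complex.abs_re_le_norm ((-R : ℝ) + y * Complex.I))
  have heq : ∫ t in -R..R, h t = (∫ t in -R..R, h (t + R * Complex.I)) -
      Complex.I * (∫ y in (0 : ℝ)..R, h (R + y * Complex.I)) +
      Complex.I * (∫ y in (0 : ℝ)..R, h ((-R : ℝ) + y * Complex.I)) := by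
    linear_combination hrect
  have habs : C / R ^ 2 * |R - -R| = 2 * (C / R) := by
    rw [abs_of_pos (by linarith)]; field_simp; ring
  have habs' : C / R ^ 2 * |R - 0| = C / R := by
    rw [sub_zero, abs_of_pos hR]; field_simp
  rw [habs] at htop
  rw [habs'] at hright hleft
  simp only [id]
  rw [heq]
  refine (norm_add_le _ _).trans ((add_le_add_left (norm_sub_le _ _) _).trans ?_)
  rw [norm_mul, norm_mul, Complex.norm_I, one_mul, one_mul, mul_div_assoc]
  linarith

lemma isBigO_inv_sub_const (c : ℂ) :
    (fun z : ℂ => (z - c)⁻¹) =O[upperInfty] fun z => z⁻¹ := by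
  refine IsBigO.mono ?_ inf_le_left
  refine .of_bound 2 ?_
  filter_upwards [tendsto_norm_cobounded_atTop.eventually_ge_atTop (2 * ‖c‖ + 1)] with z hz
  have h1 := norm_sub_norm_le z c
  have h2 := norm_nonneg c
  rw [norm_inv, norm_inv, ← div_eq_mul_inv, inv_eq_one_div,
    div_le_div_iff₀ (by linarith) (by linarith)]
  linarith

lemma isBigO_one_of_inv : (fun z : ℂ => z⁻¹) =O[upperInfty] fun _ => (1 : ℂ) :=
  (tendsto_inv₀_cobounded.mono_left inf_le_left).isBigO_one ℂ

lemma add_I_ne_zero {z : ℂ} (hz : z ∈ closedUpperHalfPlane) : z + Complex.I ≠ 0 := fun h => by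
  have := congrArg Complex.im h
  simp only [Complex.add_im, Complex.I_im, Complex.zero_im] at this
  have h0 : 0 ≤ z.im := hz
  linarith

lemma ofReal_sub_I_ne_zero (t : ℝ) : (t : ℂ) - Complex.I ≠ 0 := fun h => by
  simpa using congrArg Complex.im h

lemma closedUpperHalfPlane_mem_nhds_I : closedUpperHalfPlane ∈ 𝓝 Complex.I :=
  mem_of_superset ((isOpen_lt continuous_const Complex.continuous_im).mem_nhds
    (by simp : (0 : ℝ) < Complex.I.im)) fun z (hz : 0 < z.im) => show 0 ≤ z.im from hz.le

lemma isBigO_inv_sub_pow (c : ℂ) (n : ℕ) :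
    (fun z : ℂ => ((z - c) ^ (n + 1))⁻¹) =O[upperInfty] fun z => z⁻¹ := by
  have h1 : (fun z : ℂ => ((z - c)⁻¹) ^ n) =O[upperInfty] fun _ => (1 : ℂ) := by
    simpa using ((isBigO_inv_sub_const c).trans isBigO_one_of_inv).pow n
  simpa [pow_succ, mul_comm] using h1.mul (isBigO_inv_sub_const c)

lemma isBigO_inv_sub_pow_add_two (c : ℂ) (n : ℕ) :
    (fun z : ℂ => ((z - c) ^ (n + 2))⁻¹) =O[upperInfty] fun z => (z ^ 2)⁻¹ := by
  refine ((isBigO_inv_sub_pow c n).mul (isBigO_inv_sub_const c)).congr (fun z => ?_) fun z => ?_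
  · rw [← mul_inv, ← pow_succ]
  · rw [← mul_inv, sq]

lemma differentiableOn_inv_add_I_pow (n : ℕ) :
    DifferentiableOn ℂ (fun z : ℂ => ((z + Complex.I) ^ n)⁻¹) closedUpperHalfPlane :=
  DifferentiableOn.inv (by fun_prop) fun _ hz => pow_ne_zero _ (add_I_ne_zero hz)

lemma integrable_inv_sub_I_pow_and_integral_eq_zero (n : ℕ) :
    Integrable (fun t : ℝ => (((t : ℂ) - Complex.I) ^ (n + 2))⁻¹) ∧
      ∫ t : ℝ, (((t : ℂ) - Complex.I) ^ (n + 2))⁻¹ = 0 := by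
  have hd := differentiableOn_inv_add_I_pow (n + 2)
  have hO : (fun z : ℂ => ((z + Complex.I) ^ (n + 2))⁻¹) =O[upperInfty] fun z => (z ^ 2)⁻¹ := by
    simpa using isBigO_inv_sub_pow_add_two (-Complex.I) n
  have hflip (t : ℝ) : (((t : ℂ) - Complex.I) ^ (n + 2))⁻¹ =
      (-1) ^ (n + 2) * ((((-t : ℝ) : ℂ) + Complex.I) ^ (n + 2))⁻¹ := by
    rw [show (((-t : ℝ) : ℂ) + Complex.I) = -1 * ((t : ℂ) - Complex.I) by push_cast; ring,
      mul_pow, mul_inv, ← mul_assoc, mul_inv_cancel₀ (by simp), one_mul]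
  simp only [hflip]
  constructor
  · exact (integrable_ofReal_of_isBigO
      (continuous_comp_ofReal hd.continuousOn) hO).comp_neg.const_mul _
  · rw [integral_const_mul,
      integral_neg_eq_self (fun t : ℝ => (((t : ℂ) + Complex.I) ^ (n + 2))⁻¹) volume,
      integral_ofReal_eq_zero_of_isBigO hd hO, mul_zero]

lemma eq_add_mul_dslope (f : ℂ → ℂ) (c z : ℂ) : f z = f c + (z - c) * dslope f c z := by
  have := sub_smul_dslope f c z
  rw [smul_eq_mul] at this
  rw [this]; ring

lemma isBigO_dslope {f : ℂ → ℂ} (c : ℂ) (hO : f =O[upperInfty] fun z => z⁻¹) :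
    dslope f c =O[upperInfty] fun z => z⁻¹ := by
  have h1 : (fun z => f z - f c) =O[upperInfty] fun _ => (1 : ℂ) :=
    (hO.trans isBigO_one_of_inv).sub (isBigO_const_const _ one_ne_zero _)
  refine ((isBigO_inv_sub_const c).mul h1).congr' ?_ (by simp)
  filter_upwards [mem_inf_of_left (eventually_ne_cobounded c)] with z hz
  rw [dslope_of_ne _ hz, slope_def_field, div_eq_inv_mul]

lemma integral_div_sub_I {f : ℂ → ℂ} (hd : DifferentiableOn ℂ f closedUpperHalfPlane)
    (hO : f =O[upperInfty] fun z => z⁻¹) :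
    ∫ t : ℝ, f t / ((t : ℂ) - Complex.I) = 2 * π * Complex.I * f Complex.I := by
  set h : ℂ → ℂ := fun z => dslope f Complex.I z + f Complex.I * (z + Complex.I)⁻¹ with hh
  have hhd : DifferentiableOn ℂ h closedUpperHalfPlane :=
    ((Complex.differentiableOn_dslope closedUpperHalfPlane_mem_nhds_I).2 hd).add
      ((by simpa using differentiableOn_inv_add_I_pow 1 :
        DifferentiableOn ℂ (fun z : ℂ => (z + Complex.I)⁻¹) closedUpperHalfPlane).const_mul _)
  have hheq (z : ℂ) (hz : z ∈ closedUpperHalfPlane) (hz' : z - Complex.I ≠ 0) :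
      h z = f z * (z - Complex.I)⁻¹ -
        f Complex.I * (2 * Complex.I) * ((z - Complex.I)⁻¹ * (z + Complex.I)⁻¹) := by
    have := add_I_ne_zero hz
    rw [hh, eq_add_mul_dslope f Complex.I z]
    field_simp
    ring
  have hplus : (fun z : ℂ => (z + Complex.I)⁻¹) =O[upperInfty] fun z => z⁻¹ := by
    simpa using isBigO_inv_sub_const (-Complex.I)
  have hhO : h =O[upperInfty] fun z => (z ^ 2)⁻¹ := by
    have h1 := (hO.mul (isBigO_inv_sub_const Complex.I)).sub
      (((isBigO_inv_sub_const Complex.I).mul hplus).const_mul_left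
        (f Complex.I * (2 * Complex.I)))
    refine h1.congr' ?_ (.of_forall fun z => by simp [sq])
    filter_upwards [mem_inf_of_left (eventually_ne_cobounded Complex.I),
      mem_inf_of_right (mem_principal_self closedUpperHalfPlane)] with z hz hz'
    exact (hheq z hz' (sub_ne_zero.2 hz)).symm
  have hsplit (t : ℝ) : f t / ((t : ℂ) - Complex.I) =
      h t + f Complex.I * (2 * Complex.I) * (((1 + t ^ 2)⁻¹ : ℝ) : ℂ) := by
    rw [hheq t (ofReal_mem_closedUpperHalfPlane t) (ofReal_sub_I_ne_zero t), ← mul_inv,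
      show ((t : ℂ) - Complex.I) * (t + Complex.I) = 1 + t ^ 2 by
        linear_combination -Complex.I_sq]
    push_cast
    ring
  simp only [hsplit]
  have hint : Integrable fun t : ℝ =>
      f Complex.I * (2 * Complex.I) * (((1 + t ^ 2)⁻¹ : ℝ) : ℂ) :=
    integrable_inv_one_add_sq.ofReal.const_mul _
  rw [integral_add (integrable_ofReal_of_isBigO (continuous_comp_ofReal hhd.continuousOn) hhO)
    hint, integral_const_mul, integral_complex_ofReal, integral_univ_inv_one_add_sq,
    integral_ofReal_eq_zero_of_isBigO hhd hhO]
  ring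

/-- **Cauchy's formula for the upper half-plane**, at the point `i`, for Taylor coefficients. -/
lemma integral_div_sub_I_pow {f : ℂ → ℂ} {p : FormalMultilinearSeries ℂ ℂ ℂ}
    (hd : DifferentiableOn ℂ f closedUpperHalfPlane) (hO : f =O[upperInfty] fun z => z⁻¹)
    (hp : HasFPowerSeriesAt f p Complex.I) (n : ℕ) :
    ∫ t : ℝ, f t / ((t : ℂ) - Complex.I) ^ (n + 1) = 2 * π * Complex.I * p.coeff n := by
  induction n generalizing f p with
  | zero =>
    have h0 : p.coeff 0 = f Complex.I := hp.coeff_zero 1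
    simpa [h0] using integral_div_sub_I hd hO
  | succ n ih =>
    have hd' := (Complex.differentiableOn_dslope closedUpperHalfPlane_mem_nhds_I).2 hd
    have hO' := isBigO_dslope Complex.I hO
    have hsplit (t : ℝ) : f t / ((t : ℂ) - Complex.I) ^ (n + 1 + 1) =
        dslope f Complex.I t / ((t : ℂ) - Complex.I) ^ (n + 1) +
          f Complex.I * (((t : ℂ) - Complex.I) ^ (n + 2))⁻¹ := by
      have := ofReal_sub_I_ne_zero t
      rw [eq_add_mul_dslope f Complex.I t]
      field_simp
      ring
    obtain ⟨hint, hzero⟩ := integrable_inv_sub_I_pow_and_integral_eq_zero n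
    have hint' : Integrable fun t : ℝ =>
        dslope f Complex.I t / ((t : ℂ) - Complex.I) ^ (n + 1) := by
      refine integrable_ofReal_of_isBigO
        (h := fun z => dslope f Complex.I z / (z - Complex.I) ^ (n + 1))
        ((continuous_comp_ofReal hd'.continuousOn).div (by fun_prop)
          fun t => pow_ne_zero _ (ofReal_sub_I_ne_zero t)) ?_
      simpa only [div_eq_mul_inv, sq, mul_inv] using hO'.mul (isBigO_inv_sub_pow Complex.I n)
    simp only [hsplit]
    rw [integral_add hint' (hint.const_mul _), ih hd' hO' hp.has_fpower_series_dslope_fslope,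
      integral_const_mul, hzero, FormalMultilinearSeries.coeff_fslope, mul_zero, add_zero]

/-- For `k ≥ 1` and `x ≥ 0`,
`∫ t, e^{ixt}/(t²+1)^k dt = (2πi/(k-1)!) · d^{k-1}/dz^{k-1} [e^{ixz}(z+i)^{-k}]` at `z = i`,
i.e. `2πi` times the residue at `z = i` of `e^{ixz}/(z²+1)^k`. -/
theorem integral_exp_div_pow_eq_residue (k : ℕ) (hk : 1 ≤ k) (x : ℝ) (hx : 0 ≤ x) :
    ∫ t : ℝ, Complex.exp (Complex.I * x * t) / ((t : ℂ) ^ 2 + 1) ^ k =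
      (2 * Real.pi * Complex.I / (Nat.factorial (k - 1))) *
        iteratedDeriv (k - 1)
          (fun z : ℂ => Complex.exp (Complex.I * x * z) * (z + Complex.I) ^ (-(k : ℤ)))
          Complex.I := by
  obtain ⟨n, rfl⟩ := Nat.exists_eq_add_of_le' hk
  set f : ℂ → ℂ := fun z =>
    Complex.exp (Complex.I * x * z) * (z + Complex.I) ^ (-((n + 1 : ℕ) : ℤ)) with hf
  have hf' : f = fun z => Complex.exp (Complex.I * x * z) * ((z + Complex.I) ^ (n + 1))⁻¹ := by
    ext z
    simp only [hf]
    rw [zpow_neg, zpow_natCast]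
  have hd : DifferentiableOn ℂ f closedUpperHalfPlane := by
    rw [hf']
    exact DifferentiableOn.mul (by fun_prop) (differentiableOn_inv_add_I_pow (n + 1))
  have hexp : (fun z : ℂ => Complex.exp (Complex.I * x * z)) =O[upperInfty]
      fun _ => (1 : ℂ) := by
    refine .of_bound 1 ?_
    filter_upwards [mem_inf_of_right (mem_principal_self closedUpperHalfPlane)] with z hz
    have : 0 ≤ x * z.im := mul_nonneg hx hz
    simpa [Complex.norm_exp] using this
  have hO : f =O[upperInfty] fun z => z⁻¹ := by
    rw [hf']
    simpa using hexp.mul (isBigO_inv_sub_pow (-Complex.I) n)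
  have hp := (hd.analyticAt closedUpperHalfPlane_mem_nhds_I).hasFPowerSeriesAt
  have hmain := integral_div_sub_I_pow hd hO hp n
  rw [FormalMultilinearSeries.coeff_ofScalars] at hmain
  rw [Nat.add_sub_cancel, div_mul_eq_mul_div, mul_div_assoc, ← hmain]
  refine integral_congr_ae (.of_forall fun t => ?_)
  simp only [hf']
  rw [show (t : ℂ) ^ 2 + 1 = (t + Complex.I) * (t - Complex.I) by
    linear_combination Complex.I_sq, mul_pow, div_mul_eq_div_div, div_eq_mul_inv (Complex.exp _)]
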